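/- (Shrink-back optimization.) Let 0 < α ≤ 5π/6, let R > 0, let V be a finite set of points of the Euclidean plane, and let r : V → ℝ satisfy 0 < r u ≤ R for every u ∈ V together with the shrink-back coverage condition. Then the graph G_α determined by r preserves the connectivity of G_R: for all u, v ∈ V, u and v are joined by a path in G_α if and only if they are joined by a path in G_R. -/

import Mathlib

open EuclideanGeometry Real

noncomputable section

/-- The Euclidean plane. -/
abbrev EPlane := EuclideanSpace ℝ (Fin 2)

/-- Adjacency in the graph `G_R`: two distinct points of `V` at distance at most `R`. -/
def GRAdj (R : ℝ) (V : Finset EPlane) (u v : EPlane) : Prop :=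
  u ∈ V ∧ v ∈ V ∧ u ≠ v ∧ dist u v ≤ R

/-- A radius assignment `r` is CBTC(α)-valid if every `u ∈ V` has `0 < r u ≤ R` and
either `r u = R` or `u` has no α-gap: every direction `e` is within angle `α/2`
of some neighbor of `u` at distance at most `r u`. -/
def CBTCValid (α R : ℝ) (V : Finset EPlane) (r : EPlane → ℝ) : Prop :=
  ∀ u ∈ V, (0 < r u ∧ r u ≤ R) ∧
    (r u = R ∨ ∀ e : EPlane, e ≠ 0 → ∃ v ∈ V, v ≠ u ∧ dist u v ≤ r u ∧
      InnerProductGeometry.angle (v - u) e ≤ α / 2)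

/-- Adjacency in the graph `G_α` (symmetric closure of `N_α`):
two distinct points of `V` with `dist u v ≤ max (r u) (r v)`. -/
def GAlphaAdj (V : Finset EPlane) (r : EPlane → ℝ) (u v : EPlane) : Prop :=
  u ∈ V ∧ v ∈ V ∧ u ≠ v ∧ dist u v ≤ max (r u) (r v)

/-- The shrink-back coverage condition: every direction covered within radius `R`
is also covered within radius `r u`. -/
def ShrinkBackValid (α R : ℝ) (V : Finset EPlane) (r : EPlane → ℝ) : Prop :=
  ∀ u ∈ V, ∀ e : EPlane, e ≠ 0 →
    (∃ v ∈ V, v ≠ u ∧ dist u v ≤ R ∧ InnerProductGeometry.angle (v - u) e ≤ α / 2) →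
    ∃ v' ∈ V, v' ≠ u ∧ dist u v' ≤ r u ∧ InnerProductGeometry.angle (v' - u) e ≤ α / 2

/-- The unit vector of the plane with polar angle `t`. -/
def polarUnit (t : ℝ) : EPlane := !₂[Real.cos t, Real.sin t]

lemma inner_polarUnit (s t : ℝ) : inner ℝ (polarUnit s) (polarUnit t) = Real.cos (s - t) := by
  simp [polarUnit, PiLp.inner_apply, Fin.sum_univ_two, Real.cos_sub]
  ring

lemma norm_polarUnit (t : ℝ) : ‖polarUnit t‖ = 1 := by
  have h := inner_polarUnit t t
  rw [real_inner_self_eq_norm_sq, sub_self, Real.cos_zero] at h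
  nlinarith [norm_nonneg (polarUnit t)]

lemma polarUnit_ne_zero (t : ℝ) : polarUnit t ≠ 0 := by
  rw [← norm_ne_zero_iff, norm_polarUnit]
  exact one_ne_zero

lemma polarUnit_add_pi (t : ℝ) : polarUnit (t + Real.pi) = -polarUnit t := by
  ext i
  fin_cases i <;> simp [polarUnit]

lemma cos_angle_smul_polarUnit {p : ℝ} (hp : 0 < p) (s t : ℝ) :
    Real.cos (InnerProductGeometry.angle (p • polarUnit s) (polarUnit t)) = Real.cos (s - t) := by
  rw [InnerProductGeometry.angle_smul_left_of_pos _ _ hp, InnerProductGeometry.cos_angle,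
    inner_polarUnit, norm_polarUnit, norm_polarUnit]
  simp

lemma exists_eq_norm_smul_polarUnit_add (w : EPlane) (t : ℝ) :
    ∃ φ, |φ| ≤ Real.pi ∧ w = ‖w‖ • polarUnit (t + φ) := by
  have hw : ‖w‖ = ‖(⟨w 0, w 1⟩ : ℂ)‖ := by
    rw [EuclideanSpace.norm_eq, Complex.norm_eq_sqrt_sq_add_sq]
    simp [Fin.sum_univ_two]
  set z : ℂ := ⟨w 0, w 1⟩ with hz
  have hre : ‖z‖ * Real.cos z.arg = w 0 := Complex.norm_mul_cos_arg z
  have him : ‖z‖ * Real.sin z.arg = w 1 := Complex.norm_mul_sin_arg z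
  refine ⟨(z.arg - t : Real.Angle).toReal, Real.Angle.abs_toReal_le_pi _, ?_⟩
  set φ := (z.arg - t : Real.Angle).toReal with hφ
  have hcoe : ((t + φ : ℝ) : Real.Angle) = (z.arg : Real.Angle) := by
    rw [Real.Angle.coe_add, hφ, Real.Angle.coe_toReal]
    abel
  have hcos : Real.cos (t + φ) = Real.cos z.arg := by
    rw [← Real.Angle.cos_coe, hcoe, Real.Angle.cos_coe]
  have hsin : Real.sin (t + φ) = Real.sin z.arg := by
    rw [← Real.Angle.sin_coe, hcoe, Real.Angle.sin_coe]
  ext i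
  fin_cases i
  · simp [polarUnit, hcos, hw, hre]
  · simp [polarUnit, hsin, hw, him]

/-- If arcs of half-width `δ` about the points `φ i` cover `[-δ, δ]`, and no `φ i` is zero, then
some positive and some negative `φ i` are at distance at most `2 * δ`. -/
lemma exists_pos_neg_sub_le_of_cover {ι : Type*} (S : Finset ι) (φ : ι → ℝ) {δ : ℝ}
    (hδ : 0 < δ) (hne : ∀ i ∈ S, φ i ≠ 0)
    (hcover : ∀ θ, |θ| ≤ δ → ∃ i ∈ S, |φ i - θ| ≤ δ) :
    ∃ i ∈ S, ∃ j ∈ S, 0 < φ i ∧ φ j < 0 ∧ φ i - φ j ≤ 2 * δ := by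
  obtain ⟨k, hk, hkδ⟩ := hcover δ (abs_of_pos hδ).le
  obtain ⟨l, hl, hlδ⟩ := hcover (-δ) (by rw [abs_neg, abs_of_pos hδ])
  rw [abs_le] at hkδ hlδ
  have hkpos : 0 < φ k := lt_of_le_of_ne (by linarith) (hne k hk).symm
  have hlneg : φ l < 0 := lt_of_le_of_ne (by linarith) (hne l hl)
  obtain ⟨i, hi, hmin⟩ := Finset.exists_min_image (S.filter fun i => 0 < φ i) φ
    ⟨k, Finset.mem_filter.2 ⟨hk, hkpos⟩⟩
  obtain ⟨j, hj, hmax⟩ := Finset.exists_max_image (S.filter fun i => φ i < 0) φ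
    ⟨l, Finset.mem_filter.2 ⟨hl, hlneg⟩⟩
  have hik := hmin k (Finset.mem_filter.2 ⟨hk, hkpos⟩)
  have hlj := hmax l (Finset.mem_filter.2 ⟨hl, hlneg⟩)
  rw [Finset.mem_filter] at hi hj
  refine ⟨i, hi.1, j, hj.1, hi.2, hj.2, ?_⟩
  obtain ⟨m, hm, hmδ⟩ := hcover ((φ i + φ j) / 2) (by
    rw [abs_le]; constructor <;> linarith [hi.2, hj.2])
  rw [abs_le] at hmδ
  rcases (hne m hm).lt_or_gt with hneg | hpos
  · linarith [hmax m (Finset.mem_filter.2 ⟨hm, hneg⟩)]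
  · linarith [hmin m (Finset.mem_filter.2 ⟨hm, hpos⟩)]

lemma abs_le_of_cos_le_cos {x δ : ℝ} (hδ : 0 ≤ δ) (hx : |x| < 2 * Real.pi - δ)
    (h : Real.cos δ ≤ Real.cos x) : |x| ≤ δ := by
  by_contra! hlt
  rw [← Real.cos_abs x] at h
  rcases le_total |x| Real.pi with hle | hge
  · exact absurd h (not_le.2 (Real.cos_lt_cos_of_nonneg_of_le_pi hδ hle hlt))
  · have := Real.cos_lt_cos_of_nonneg_of_le_pi (x := δ) (y := 2 * Real.pi - |x|) hδ
      (by linarith) (by linarith)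
    rw [Real.cos_two_pi_sub] at this
    linarith

/-- If the points of `S` cover, as seen from `u`, all directions within `α / 2` of `v`, but none is
closer to `v` than `u` is, then two of them flank the direction of `v` with an angle at most `α`
between them. -/
lemma exists_flanking {α t : ℝ} (hα : 0 < α) (hα' : α < Real.pi) (S : Finset EPlane)
    {u v : EPlane} (huv : v ≠ u) (hv : v - u = dist u v • polarUnit t) (hne : ∀ w ∈ S, w ≠ u)
    (hcover : ∀ e : EPlane, e ≠ 0 → InnerProductGeometry.angle (v - u) e ≤ α / 2 →
      ∃ w ∈ S, InnerProductGeometry.angle (w - u) e ≤ α / 2)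
    (hlt : ∀ w ∈ S, dist u w < dist u v) (hfar : ∀ w ∈ S, dist u v ≤ dist w v) :
    ∃ w₁ ∈ S, ∃ w₂ ∈ S, ∃ a b, 0 < a ∧ 0 < b ∧ a + b ≤ α ∧
      w₁ - u = dist u w₁ • polarUnit (t + a) ∧ w₂ - u = dist u w₂ • polarUnit (t - b) := by
  choose φ hφπ hφ using fun w : EPlane => exists_eq_norm_smul_polarUnit_add (w - u) t
  have hnorm : ∀ w, ‖w - u‖ = dist u w := fun w => (dist_eq_norm' u w).symm
  simp only [hnorm] at hφ
  have hpos : ∀ w ∈ S, 0 < dist u w := fun w hw => dist_pos.2 (hne w hw).symm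
  have hφne : ∀ w ∈ S, φ w ≠ 0 := by
    intro w hw h0
    have h1 : v - w = (dist u v - dist u w) • polarUnit t := by
      have h2 := hφ w
      rw [h0, add_zero] at h2
      rw [sub_smul, ← hv, ← h2]
      abel
    have h3 := hfar w hw
    rw [dist_eq_norm' w v, h1, norm_smul, norm_polarUnit, mul_one, Real.norm_eq_abs,
      abs_of_pos (sub_pos.2 (hlt w hw))] at h3
    linarith [hpos w hw]
  obtain ⟨i, hi, j, hj, hipos, hjneg, hij⟩ :=
    exists_pos_neg_sub_le_of_cover S φ (half_pos hα) hφne (by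
      intro θ hθ
      have hdir : InnerProductGeometry.angle (v - u) (polarUnit (t + θ)) ≤ α / 2 := by
        rw [hv, InnerProductGeometry.angle_smul_left_of_pos _ _ (dist_pos.2 huv.symm),
          InnerProductGeometry.angle, inner_polarUnit, norm_polarUnit, norm_polarUnit,
          sub_add_cancel_left, Real.cos_neg, ← Real.cos_abs, mul_one, div_one,
          Real.arccos_cos (abs_nonneg _) (by linarith)]
        exact hθ
      obtain ⟨w, hw, hwθ⟩ := hcover _ (polarUnit_ne_zero (t + θ)) hdir
      refine ⟨w, hw, abs_le_of_cos_le_cos (half_pos hα).le ?_ ?_⟩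
      · calc |φ w - θ| ≤ |φ w| + |θ| := abs_sub _ _
          _ < _ := by linarith [hφπ w]
      · rw [← add_sub_add_left_eq_sub (φ w) θ t, ← cos_angle_smul_polarUnit (hpos w hw), ← hφ w]
        exact Real.cos_le_cos_of_nonneg_of_le_pi (InnerProductGeometry.angle_nonneg _ _)
          (by linarith) hwθ)
  refine ⟨i, hi, j, hj, φ i, -φ j, hipos, by linarith, by linarith, hφ i, ?_⟩
  rw [sub_neg_eq_add]
  exact hφ j

lemma sq_add_mul_add_neg_of_endpoints {l m x β γ : ℝ} (hlx : l ≤ x) (hxm : x ≤ m) (hlm : l < m)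
    (hl : l ^ 2 + β * l + γ < 0) (hm : m ^ 2 + β * m + γ < 0) : x ^ 2 + β * x + γ < 0 := by
  rcases hlx.eq_or_lt with rfl | hlx
  · exact hl
  · have h : (m - l) * (x ^ 2 + β * x + γ) = (m - x) * (l ^ 2 + β * l + γ)
        + (x - l) * (m ^ 2 + β * m + γ) - (m - l) * ((x - l) * (m - x)) := by ring
    have h1 : (m - x) * (l ^ 2 + β * l + γ) ≤ 0 :=
      mul_nonpos_of_nonneg_of_nonpos (sub_nonneg.2 hxm) hl.le
    have h2 : (x - l) * (m ^ 2 + β * m + γ) < 0 := mul_neg_of_pos_of_neg (sub_pos.2 hlx) hm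
    have h3 : 0 ≤ (m - l) * ((x - l) * (m - x)) :=
      mul_nonneg (sub_pos.2 hlm).le (mul_nonneg (sub_pos.2 hlx).le (sub_nonneg.2 hxm))
    exact neg_of_mul_neg_right (by linarith) (sub_pos.2 hlm).le

lemma one_sub_two_cos_add_four_cos_mul_cos_neg {a c : ℝ} (ha : Real.pi / 3 < a)
    (hc : Real.pi / 3 < c) (hac : a + c ≤ 5 * Real.pi / 6) :
    1 - 2 * Real.cos a + 4 * Real.cos c * Real.cos (a + c) < 0 := by
  have hπ := Real.pi_pos
  have h1 : 2 * Real.cos c * Real.cos (a + c) = Real.cos (a + 2 * c) + Real.cos a := by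
    have hadd := Real.cos_add (a + c) c
    have hsub := Real.cos_sub (a + c) c
    rw [show a + c + c = a + 2 * c by ring] at hadd
    rw [add_sub_cancel_right] at hsub
    linarith
  have h2 : Real.cos (a + 2 * c - Real.pi) = -Real.cos (a + 2 * c) := Real.cos_sub_pi _
  have h3 : 1 / 2 < Real.cos (a + 2 * c - Real.pi) := by
    rw [← Real.cos_pi_div_three]
    exact Real.cos_lt_cos_of_nonneg_of_le_pi (by linarith) (by linarith) (by linarith)
  linarith

lemma one_add_cos_add_lt {a c : ℝ} (ha : 0 < a) (hc : 0 < c) (hac : a + c < Real.pi) :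
    1 + Real.cos (a + c) < Real.cos a + Real.cos c := by
  have h1 : 1 + Real.cos (a + c) = 2 * Real.cos ((a + c) / 2) ^ 2 := by
    rw [Real.cos_sq]
    ring_nf
  have h2 : 0 < Real.cos ((a + c) / 2) :=
    Real.cos_pos_of_mem_Ioo ⟨by linarith, by linarith⟩
  have h3 : Real.cos ((a + c) / 2) < Real.cos ((a - c) / 2) := by
    rw [← Real.cos_abs ((a - c) / 2)]
    refine Real.cos_lt_cos_of_nonneg_of_le_pi (abs_nonneg _) (by linarith) ?_
    rw [abs_lt]
    constructor <;> linarith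
  rw [h1, Real.cos_add_cos, sq, ← mul_assoc]
  exact mul_lt_mul_of_pos_left h3 (by positivity)

lemma pi_div_three_lt_of_cos_lt_half {a : ℝ} (ha : 0 ≤ a) (h : Real.cos a < 1 / 2) :
    Real.pi / 3 < a := by
  by_contra! hle
  have := Real.cos_le_cos_of_nonneg_of_le_pi ha (by linarith [Real.pi_pos]) hle
  rw [Real.cos_pi_div_three] at this
  linarith

lemma quadrilateral_quadratic_neg {a c p q : ℝ} (ha : 0 < a) (hc : 0 < c)
    (hac : a + c ≤ 5 * Real.pi / 6) (hp : p < 1) (hq : q < 1)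
    (hpa : 2 * Real.cos a ≤ p) (hqc : 2 * Real.cos c ≤ q) :
    p ^ 2 + q ^ 2 - 2 * p * Real.cos a - 2 * q * Real.cos c + 2 * p * q * Real.cos (a + c) < 0 := by
  have hπ := Real.pi_pos
  have ha3 : Real.pi / 3 < a := pi_div_three_lt_of_cos_lt_half ha.le (by linarith)
  have hc3 : Real.pi / 3 < c := pi_div_three_lt_of_cos_lt_half hc.le (by linarith)
  have hA : 0 < Real.cos a := Real.cos_pos_of_mem_Ioo ⟨by linarith, by linarith⟩
  have hC : 0 < Real.cos c := Real.cos_pos_of_mem_Ioo ⟨by linarith, by linarith⟩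
  have hK : Real.cos (a + c) < 0 :=
    Real.cos_neg_of_pi_div_two_lt_of_lt (by linarith) (by linarith)
  have h11 := one_add_cos_add_lt ha hc (by linarith)
  have h12 := one_sub_two_cos_add_four_cos_mul_cos_neg ha3 hc3 hac
  have h21 := one_sub_two_cos_add_four_cos_mul_cos_neg hc3 ha3 (by linarith)
  rw [add_comm c a] at h21
  have h22 : Real.cos a * Real.cos c * Real.cos (a + c) < 0 :=
    mul_neg_of_pos_of_neg (mul_pos hA hC) hK
  have hleft := sq_add_mul_add_neg_of_endpoints (x := q)
    (β := 4 * Real.cos a * Real.cos (a + c) - 2 * Real.cos c) (γ := 0) hqc hq.le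
    (by linarith) (by linarith) (by linarith)
  have hright := sq_add_mul_add_neg_of_endpoints (x := q)
    (β := 2 * Real.cos (a + c) - 2 * Real.cos c) (γ := 1 - 2 * Real.cos a) hqc hq.le
    (by linarith) (by linarith) (by linarith)
  have h := sq_add_mul_add_neg_of_endpoints (x := p)
    (β := 2 * q * Real.cos (a + c) - 2 * Real.cos a) (γ := q ^ 2 - 2 * q * Real.cos c) hpa hp.le
    (by linarith) (by linarith) (by linarith)
  linarith

lemma norm_smul_polarUnit_sub_sq (p q s t : ℝ) :
    ‖p • polarUnit s - q • polarUnit t‖ ^ 2 = p ^ 2 - 2 * p * q * Real.cos (s - t) + q ^ 2 := by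
  rw [norm_sub_sq_real, real_inner_smul_left, real_inner_smul_right, inner_polarUnit, norm_smul,
    norm_smul, norm_polarUnit, norm_polarUnit, Real.norm_eq_abs, Real.norm_eq_abs, mul_one,
    mul_one, sq_abs, sq_abs]
  ring

/-- Points `w` near `u` and `x` near `v`, on the same side of the line `uv`, are closer to each
other than `u` and `v` are if their angular deviations from that line add up to at most `5π/6`. -/
lemma dist_lt_of_add_angle_le {t a c : ℝ} {u v w x : EPlane}
    (hv : v - u = dist u v • polarUnit t) (hw : w - u = dist u w • polarUnit (t + a))
    (hx : x - v = dist v x • polarUnit (t + Real.pi - c)) (hwu : w ≠ u) (hxv : x ≠ v)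
    (hwd : dist u w < dist u v) (hxd : dist v x < dist u v)
    (hwv : dist u v ≤ dist w v) (hxu : dist u v ≤ dist x u)
    (ha : 0 < a) (hc : 0 < c) (hac : a + c ≤ 5 * Real.pi / 6) :
    dist w x < dist u v := by
  have hp : 0 < dist u w := dist_pos.2 hwu.symm
  have hq : 0 < dist v x := dist_pos.2 hxv.symm
  have hx' : x - v = -(dist v x • polarUnit (t - c)) := by
    rw [hx, show t + Real.pi - c = t - c + Real.pi by ring, polarUnit_add_pi, smul_neg]
  generalize hd : dist u v = d at *
  generalize dist u w = p at *
  generalize dist v x = q at *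
  have hd0 : 0 < d := hp.trans hwd
  have hwv2 : dist w v ^ 2 = p ^ 2 - 2 * p * d * Real.cos a + d ^ 2 := by
    rw [dist_eq_norm, show w - v = (w - u) - (v - u) by abel, hw, hv, norm_smul_polarUnit_sub_sq,
      add_sub_cancel_left]
  have hxu2 : dist x u ^ 2 = d ^ 2 - 2 * d * q * Real.cos c + q ^ 2 := by
    rw [dist_eq_norm, show x - u = (v - u) + (x - v) by abel, hx', hv, ← sub_eq_add_neg,
      norm_smul_polarUnit_sub_sq, sub_sub_cancel]
  have hwx2 : dist w x ^ 2 = d ^ 2 + p ^ 2 + q ^ 2 - 2 * p * d * Real.cos a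
      - 2 * d * q * Real.cos c + 2 * p * q * Real.cos (a + c) := by
    have e : w - x = (p • polarUnit (t + a) - d • polarUnit t) + q • polarUnit (t - c) := by
      rw [← hw, ← hv, ← neg_neg (q • _), ← hx']
      abel
    rw [dist_eq_norm, e, norm_add_sq_real, norm_smul_polarUnit_sub_sq, inner_sub_left,
      real_inner_smul_left, real_inner_smul_left, real_inner_smul_right, real_inner_smul_right,
      inner_polarUnit, inner_polarUnit, norm_smul, norm_polarUnit, Real.norm_eq_abs, mul_one,
      sq_abs, add_sub_cancel_left, sub_sub_cancel, show t + a - (t - c) = a + c by ring]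
    ring
  have hpa : 2 * Real.cos a ≤ p / d := by
    rw [le_div_iff₀ hd0]
    refine le_of_mul_le_mul_left ?_ hp
    nlinarith [pow_le_pow_left₀ hd0.le hwv 2]
  have hqc : 2 * Real.cos c ≤ q / d := by
    rw [le_div_iff₀ hd0]
    refine le_of_mul_le_mul_left ?_ hq
    nlinarith [pow_le_pow_left₀ hd0.le hxu 2]
  have h := quadrilateral_quadratic_neg ha hc hac ((div_lt_one hd0).2 hwd)
    ((div_lt_one hd0).2 hxd) hpa hqc
  have h' := mul_neg_of_pos_of_neg (pow_pos hd0 2) h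
  refine lt_of_pow_lt_pow_left₀ 2 hd0.le ?_
  rw [hwx2]
  have e : d ^ 2 * ((p / d) ^ 2 + (q / d) ^ 2 - 2 * (p / d) * Real.cos a
      - 2 * (q / d) * Real.cos c + 2 * (p / d) * (q / d) * Real.cos (a + c))
      = p ^ 2 + q ^ 2 - 2 * p * d * Real.cos a - 2 * d * q * Real.cos c
        + 2 * p * q * Real.cos (a + c) := by
    field_simp
  linarith

lemma GAlphaAdj.symm {V : Finset EPlane} {r : EPlane → ℝ} {u v : EPlane}
    (h : GAlphaAdj V r u v) : GAlphaAdj V r v u :=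
  ⟨h.2.1, h.1, h.2.2.1.symm, by rw [dist_comm, max_comm]; exact h.2.2.2⟩

/-- The flanking neighbors of `u` within radius `r u` about the direction of a point `v` that is
out of that radius but within `R`. -/
lemma ShrinkBackValid.exists_flanking {α R t : ℝ} {V : Finset EPlane} {r : EPlane → ℝ}
    (hsb : ShrinkBackValid α R V r) (hα : 0 < α) (hα' : α < Real.pi) {u v : EPlane} (hu : u ∈ V)
    (hv : v ∈ V) (huv : v ≠ u) (hR : dist u v ≤ R) (hlt : r u < dist u v)
    (ht : v - u = dist u v • polarUnit t)
    (hfar : ∀ w ∈ V, GAlphaAdj V r u w → dist u v ≤ dist w v) :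
    ∃ w₁ w₂ : EPlane, ∃ a b : ℝ,
      (GAlphaAdj V r u w₁ ∧ dist u w₁ < dist u v ∧ w₁ - u = dist u w₁ • polarUnit (t + a)) ∧
      (GAlphaAdj V r u w₂ ∧ dist u w₂ < dist u v ∧ w₂ - u = dist u w₂ • polarUnit (t - b)) ∧
      0 < a ∧ 0 < b ∧ a + b ≤ α := by
  classical
  have hadj : ∀ w ∈ V.filter (fun w => w ≠ u ∧ dist u w ≤ r u), GAlphaAdj V r u w := by
    intro w hw
    rw [Finset.mem_filter] at hw
    exact ⟨hu, hw.1, hw.2.1.symm, le_max_of_le_left hw.2.2⟩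
  have hshort : ∀ w ∈ V.filter (fun w => w ≠ u ∧ dist u w ≤ r u), dist u w < dist u v :=
    fun w hw => (Finset.mem_filter.1 hw).2.2.trans_lt hlt
  obtain ⟨w₁, h₁, w₂, h₂, a, b, ha, hb, hab, e₁, e₂⟩ :=
    _root_.exists_flanking hα hα' (V.filter fun w => w ≠ u ∧ dist u w ≤ r u) huv ht
      (fun w hw => (Finset.mem_filter.1 hw).2.1)
      (fun e he hang => by
        obtain ⟨w, hw, hwu, hwr, hwe⟩ := hsb u hu e he ⟨v, hv, huv, hR, hang⟩
        exact ⟨w, Finset.mem_filter.2 ⟨hw, hwu, hwr⟩, hwe⟩)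
      hshort (fun w hw => hfar w (Finset.mem_filter.1 hw).1 (hadj w hw))
  exact ⟨w₁, w₂, a, b, ⟨hadj _ h₁, hshort _ h₁, e₁⟩, ⟨hadj _ h₂, hshort _ h₂, e₂⟩, ha, hb, hab⟩

/-- The replacement step: an edge of `G_R` missing from `G_α` can be traded for a strictly shorter
pair of points of `V` whose members are equal or `G_α`-adjacent to the original endpoints. -/
lemma ShrinkBackValid.exists_dist_lt {α R : ℝ} {V : Finset EPlane} {r : EPlane → ℝ}
    (hsb : ShrinkBackValid α R V r) (hα : 0 < α) (hα' : α ≤ 5 * Real.pi / 6) {u v : EPlane}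
    (hR : GRAdj R V u v) (hnot : ¬ GAlphaAdj V r u v) :
    ∃ u' ∈ V, ∃ v' ∈ V, Relation.ReflTransGen (GAlphaAdj V r) u u' ∧
      Relation.ReflTransGen (GAlphaAdj V r) v' v ∧ dist u' v' < dist u v := by
  obtain ⟨hu, hv, huv, hdR⟩ := hR
  have hlt : max (r u) (r v) < dist u v := by
    by_contra! h
    exact hnot ⟨hu, hv, huv, h⟩
  rw [max_lt_iff] at hlt
  by_contra! hno
  have hfaru : ∀ w ∈ V, GAlphaAdj V r u w → dist u v ≤ dist w v := fun w hw h =>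
    hno w hw v hv (.single h) .refl
  have hfarv : ∀ w ∈ V, GAlphaAdj V r v w → dist u v ≤ dist w u := fun w hw h => by
    rw [dist_comm w u]
    exact hno u hu w hw .refl (.single h.symm)
  obtain ⟨t, -, ht⟩ := exists_eq_norm_smul_polarUnit_add (v - u) 0
  rw [zero_add, ← dist_eq_norm'] at ht
  have ht' : u - v = dist v u • polarUnit (t + Real.pi) := by
    rw [polarUnit_add_pi, smul_neg, dist_comm, ← ht, neg_sub]
  have hαπ : α < Real.pi := by linarith [Real.pi_pos]
  obtain ⟨w₁, w₂, a, b, ⟨hw₁, hl₁, e₁⟩, ⟨hw₂, hl₂, e₂⟩, ha, hb, hab⟩ :=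
    hsb.exists_flanking hα hαπ hu hv huv.symm hdR hlt.1 ht hfaru
  obtain ⟨x₁, x₂, c, d, ⟨hx₁, k₁, f₁⟩, ⟨hx₂, k₂, f₂⟩, hc, hd, hcd⟩ :=
    hsb.exists_flanking hα hαπ hv hu huv (by rwa [dist_comm]) (by rw [dist_comm]; exact hlt.2) ht'
      (by rwa [dist_comm v u])
  rw [dist_comm v u] at k₁ k₂
  have hsum : a + d ≤ 5 * Real.pi / 6 ∨ c + b ≤ 5 * Real.pi / 6 := by
    by_contra! h
    linarith [h.1, h.2]
  rcases hsum with h | h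
  · exact absurd (dist_lt_of_add_angle_le ht e₁ f₂ hw₁.2.2.1.symm hx₂.2.2.1.symm hl₁ k₂
      (hfaru _ hw₁.2.1 hw₁) (hfarv _ hx₂.2.1 hx₂) ha hd h)
      (not_lt.2 (hno _ hw₁.2.1 _ hx₂.2.1 (.single hw₁) (.single hx₂.symm)))
  · have e₂' : w₂ - u = dist u w₂ • polarUnit (t + Real.pi + Real.pi - b) := by
      rw [show t + Real.pi + Real.pi - b = t - b + Real.pi + Real.pi by ring, polarUnit_add_pi,
        polarUnit_add_pi, neg_neg]
      exact e₂
    have hlt' := dist_lt_of_add_angle_le ht' f₁ e₂' hx₁.2.2.1.symm hw₂.2.2.1.symm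
      (by rwa [dist_comm v u]) (by rwa [dist_comm v u])
      (by rw [dist_comm v u]; exact hfarv _ hx₁.2.1 hx₁)
      (by rw [dist_comm v u]; exact hfaru _ hw₂.2.1 hw₂) hc hb h
    rw [dist_comm x₁ w₂, dist_comm v u] at hlt'
    exact absurd hlt' (not_lt.2 (hno _ hw₂.2.1 _ hx₁.2.1 (.single hw₂) (.single hx₁.symm)))

/-- Shrink-back optimization: for `0 < α ≤ 5π/6` and a radius assignment satisfying
`0 < r u ≤ R` and the shrink-back coverage condition, `G_α` preserves the
connectivity of `G_R`. -/
theorem cbtc_shrink_back_connectivity (α R : ℝ) (hα : 0 < α) (hα' : α ≤ 5 * Real.pi / 6)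
    (hR : 0 < R) (V : Finset EPlane) (r : EPlane → ℝ)
    (hr : ∀ u ∈ V, 0 < r u ∧ r u ≤ R) (hsb : ShrinkBackValid α R V r)
    (u v : EPlane) (hu : u ∈ V) (hv : v ∈ V) :
    Relation.ReflTransGen (GAlphaAdj V r) u v ↔ Relation.ReflTransGen (GRAdj R V) u v := by
  constructor
  · refine Relation.ReflTransGen.mono (fun x y h => ?_) u v
    exact ⟨h.1, h.2.1, h.2.2.1, h.2.2.2.trans (max_le (hr x h.1).2 (hr y h.2.1).2)⟩
  · intro h
    have hedge : ∀ x y, GRAdj R V x y → Relation.ReflTransGen (GAlphaAdj V r) x y := by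
      classical
      by_contra! hbad
      obtain ⟨x, y, hxy, hn⟩ := hbad
      obtain ⟨⟨x, y⟩, hmem, hmin⟩ := Finset.exists_min_image
        ((V ×ˢ V).filter fun z => GRAdj R V z.1 z.2 ∧
          ¬ Relation.ReflTransGen (GAlphaAdj V r) z.1 z.2) (fun z => dist z.1 z.2)
        ⟨(x, y), Finset.mem_filter.2 ⟨Finset.mem_product.2 ⟨hxy.1, hxy.2.1⟩, hxy, hn⟩⟩
      obtain ⟨-, hxy, hn⟩ := Finset.mem_filter.1 hmem
      obtain ⟨x', hx', y', hy', hxx', hyy', hlt⟩ :=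
        hsb.exists_dist_lt hα hα' hxy fun h => hn (.single h)
      have hn' : ¬ Relation.ReflTransGen (GAlphaAdj V r) x' y' := fun h =>
        hn (hxx'.trans (h.trans hyy'))
      have hne : x' ≠ y' := by
        rintro rfl
        exact hn' .refl
      exact absurd hlt (not_lt.2 (hmin (x', y') (Finset.mem_filter.2
        ⟨Finset.mem_product.2 ⟨hx', hy'⟩, ⟨hx', hy', hne, hlt.le.trans hxy.2.2.2⟩, hn'⟩)))
    exact h.lift' id hedge
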